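/- Suppose H : [0,T] × C × ℝⁿ → ℝ satisfies conditions (A.1)–(A.5). Then, for every compact set D ⊂ C, there exists a set E¹_H ⊂ [0,T) with μ(E¹_H) = T such that, for any t ∈ E¹_H, x(·) ∈ D, s ∈ ℝⁿ, one has lim_{τ→t⁺} (1/(τ−t)) ∫ₜ^τ H(ξ, x(·), s) dξ = H(t, x(·), s); that is, every t ∈ E¹_H is a Lebesgue point of ξ ↦ H(ξ, x(·), s) simultaneously for all x(·) ∈ D and s ∈ ℝⁿ. -/

import Mathlib

open MeasureTheory Set Filter Topology

noncomputable section

attribute [local instance] Classical.propDecidable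

/-- Euclidean space `ℝⁿ`. -/
abbrev Euc (n : ℕ) : Type := EuclideanSpace ℝ (Fin n)

/-- The path space `C([-h,T], ℝⁿ)` with the sup norm. -/
abbrev PathSp (n : ℕ) (h T : ℝ) : Type := ContinuousMap (Set.Icc (-h) T) (Euc n)

/-- The time map `τ ↦ τ ∧ t` on `[-h,T]` (for `t ∈ [0,T]`, `h ≥ 0`, this is `min τ t`). -/
def stopTime (h T t : ℝ) (τ : Set.Icc (-h) T) : Set.Icc (-h) T :=
  ⟨max (-h) (min τ.1 t), le_max_left _ _,
    max_le (le_trans τ.2.1 τ.2.2) (le_trans (min_le_left _ _) τ.2.2)⟩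

lemma continuous_stopTime (h T t : ℝ) : Continuous (stopTime h T t) :=
  Continuous.subtype_mk
    (continuous_const.max (continuous_subtype_val.min continuous_const)) _

/-- The stopped path `x(· ∧ t)`. -/
def stopPath {n : ℕ} {h T : ℝ} (t : ℝ) (x : PathSp n h T) : PathSp n h T :=
  x.comp ⟨stopTime h T t, continuous_stopTime h T t⟩

/-- Evaluation of a path at a real time (times outside `[-h,T]` are projected). -/
def evalP {n : ℕ} {h T : ℝ} (x : PathSp n h T) (τ : ℝ) : Euc n :=
  if hc : -h ≤ T then x (Set.projIcc (-h) T hc τ) else 0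

/-- The `L¹([0,T])` distance between two functions. -/
def L1dist (T : ℝ) (c₁ c₂ : ℝ → ℝ) : ℝ := ∫ τ in Set.Icc (0:ℝ) T, |c₁ τ - c₂ τ|

/-- A nonnegative function in `L¹([0,T],ℝ)`. -/
def IntegNonneg (T : ℝ) (c : ℝ → ℝ) : Prop :=
  IntegrableOn c (Set.Icc 0 T) volume ∧ ∀ τ ∈ Set.Icc (0:ℝ) T, 0 ≤ c τ

/-- `AC(t,x(·))`, presented with an explicit derivative witness: pairs `(y, y')`
such that `y(·∧t) = x(·∧t)`, `y'` is integrable on `[t,T]`, and `y` is the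
indefinite integral of `y'` on `[t,T]` (i.e. `y|_{[t,T]}` is absolutely continuous
with a.e. derivative `y'`). -/
def ACPair {n : ℕ} {h T : ℝ} (t : ℝ) (x : PathSp n h T) :
    Set (PathSp n h T × (ℝ → Euc n)) :=
  {p | stopPath t p.1 = stopPath t x ∧ IntervalIntegrable p.2 volume t T ∧
       ∀ τ ∈ Set.Icc t T, evalP p.1 τ = evalP p.1 t + ∫ ξ in t..τ, p.2 ξ}

/-- The set `AC(t,x(·))`. -/
def ACSet {n : ℕ} {h T : ℝ} (t : ℝ) (x : PathSp n h T) : Set (PathSp n h T) :=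
  {y | ∃ y', (y, y') ∈ ACPair t x}

/-- Pairs `(y, y')` with `y ∈ Y(t,x(·);c(·))` and derivative witness `y'`. -/
def YPair {n : ℕ} {h T : ℝ} (t : ℝ) (x : PathSp n h T) (c : ℝ → ℝ) :
    Set (PathSp n h T × (ℝ → Euc n)) :=
  {p | p ∈ ACPair t x ∧
       ∀ᵐ τ ∂(volume.restrict (Set.Icc t T)), ‖p.2 τ‖ ≤ c τ * (1 + ‖stopPath τ p.1‖)}

/-- The set `Y(t,x(·);c(·))`. -/
def YSet {n : ℕ} {h T : ℝ} (t : ℝ) (x : PathSp n h T) (c : ℝ → ℝ) :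
    Set (PathSp n h T) :=
  {y | ∃ y', (y, y') ∈ YPair t x c}

/-- Condition (A.1): measurability in `t` on `[0,T]`. -/
def CondA1 {n : ℕ} {h T : ℝ} (H : ℝ → PathSp n h T → Euc n → ℝ) : Prop :=
  ∀ (x : PathSp n h T) (s : Euc n),
    Measurable ((Set.Icc (0:ℝ) T).restrict (fun t => H t x s))

/-- Condition (A.2): continuity in `(x,s)` for a.e. `t`. -/
def CondA2 {n : ℕ} {h T : ℝ} (H : ℝ → PathSp n h T → Euc n → ℝ) : Prop :=
  ∃ E : Set ℝ, E ⊆ Set.Icc 0 T ∧ volume E = ENNReal.ofReal T ∧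
    ∀ t ∈ E, Continuous (fun p : PathSp n h T × Euc n => H t p.1 p.2)

/-- Condition (A.3) for a given compact set `D` and function `λ_H(·;D)`. -/
def CondA3For {n : ℕ} {h T : ℝ} (H : ℝ → PathSp n h T → Euc n → ℝ)
    (D : Set (PathSp n h T)) (lam : ℝ → ℝ) : Prop :=
  IntegNonneg T lam ∧
  ∀ x₁ ∈ D, ∀ x₂ ∈ D, ∀ s : Euc n,
    ∃ E : Set ℝ, E ⊆ Set.Icc 0 T ∧ volume E = ENNReal.ofReal T ∧
      ∀ t ∈ E, |H t x₁ s - H t x₂ s| ≤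
        lam t * (1 + ‖s‖) * ‖stopPath t x₁ - stopPath t x₂‖

/-- Condition (A.3). -/
def CondA3 {n : ℕ} {h T : ℝ} (H : ℝ → PathSp n h T → Euc n → ℝ) : Prop :=
  ∀ D : Set (PathSp n h T), IsCompact D → ∃ lam : ℝ → ℝ, CondA3For H D lam

/-- Condition (A.4), with the function `c_H(·)` made explicit. -/
def CondA4 {n : ℕ} {h T : ℝ} (H : ℝ → PathSp n h T → Euc n → ℝ) (cH : ℝ → ℝ) : Prop :=
  IntegNonneg T cH ∧
  ∃ E : Set ℝ, E ⊆ Set.Icc 0 T ∧ volume E = ENNReal.ofReal T ∧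
    ∀ t ∈ E, ∀ (x : PathSp n h T) (s₁ s₂ : Euc n),
      |H t x s₁ - H t x s₂| ≤ cH t * (1 + ‖stopPath t x‖) * ‖s₁ - s₂‖

/-- Condition (A.5) for a given compact set `D` and function `m_H(·;D)`. -/
def CondA5For {n : ℕ} {h T : ℝ} (H : ℝ → PathSp n h T → Euc n → ℝ)
    (D : Set (PathSp n h T)) (m : ℝ → ℝ) : Prop :=
  IntegNonneg T m ∧
  ∀ x ∈ D, ∃ E : Set ℝ, E ⊆ Set.Icc 0 T ∧ volume E = ENNReal.ofReal T ∧
    ∀ t ∈ E, |H t x (0 : Euc n)| ≤ m t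

/-- Condition (A.5). -/
def CondA5 {n : ℕ} {h T : ℝ} (H : ℝ → PathSp n h T → Euc n → ℝ) : Prop :=
  ∀ D : Set (PathSp n h T), IsCompact D → ∃ m : ℝ → ℝ, CondA5For H D m

/-- Conditions (A.1)–(A.5), with the function `c_H(·)` from (A.4) made explicit. -/
def CondA {n : ℕ} {h T : ℝ} (H : ℝ → PathSp n h T → Euc n → ℝ) (cH : ℝ → ℝ) : Prop :=
  CondA1 H ∧ CondA2 H ∧ CondA3 H ∧ CondA4 H cH ∧ CondA5 H

/-- A functional `φ` on `[0,T] × C` is non-anticipative. -/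
def NonAnticipative {n : ℕ} {h T : ℝ} (φ : ℝ → PathSp n h T → ℝ) : Prop :=
  ∀ t ∈ Set.Icc (0:ℝ) T, ∀ x : PathSp n h T, φ t x = φ t (stopPath t x)

/-- Property (U) from the definition of an upper solution. -/
def PropU {n : ℕ} {h T : ℝ} (H : ℝ → PathSp n h T → Euc n → ℝ) (cH : ℝ → ℝ)
    (φ : ℝ → PathSp n h T → ℝ) : Prop :=
  ∀ t ∈ Set.Ico (0:ℝ) T, ∀ x : PathSp n h T, ∀ s : Euc n, ∀ τ ∈ Set.Ioc t T,
    ∃ p ∈ YPair t x cH,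
      φ τ p.1 - ∫ ξ in t..τ, (@inner ℝ _ _ s (p.2 ξ) - H ξ p.1 s) ≤ φ t x

/-- Property (L) from the definition of a lower solution. -/
def PropL {n : ℕ} {h T : ℝ} (H : ℝ → PathSp n h T → Euc n → ℝ) (cH : ℝ → ℝ)
    (φ : ℝ → PathSp n h T → ℝ) : Prop :=
  ∀ t ∈ Set.Ico (0:ℝ) T, ∀ x : PathSp n h T, ∀ s : Euc n, ∀ τ ∈ Set.Ioc t T,
    ∃ p ∈ YPair t x cH,
      φ t x ≤ φ τ p.1 - ∫ ξ in t..τ, (@inner ℝ _ _ s (p.2 ξ) - H ξ p.1 s)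

/-- Upper solution of the Cauchy problem for `H` (with `c_H` from (A.4)) and `σ`. -/
def UpperSol {n : ℕ} {h T : ℝ} (H : ℝ → PathSp n h T → Euc n → ℝ) (cH : ℝ → ℝ)
    (σ : PathSp n h T → ℝ) (φ : ℝ → PathSp n h T → ℝ) : Prop :=
  NonAnticipative φ ∧
  LowerSemicontinuousOn (fun p : ℝ × PathSp n h T => φ p.1 p.2)
    (Set.Icc 0 T ×ˢ (Set.univ : Set (PathSp n h T))) ∧
  (∀ x : PathSp n h T, σ x ≤ φ T x) ∧
  PropU H cH φ

/-- Lower solution of the Cauchy problem for `H` (with `c_H` from (A.4)) and `σ`. -/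
def LowerSol {n : ℕ} {h T : ℝ} (H : ℝ → PathSp n h T → Euc n → ℝ) (cH : ℝ → ℝ)
    (σ : PathSp n h T → ℝ) (φ : ℝ → PathSp n h T → ℝ) : Prop :=
  NonAnticipative φ ∧
  UpperSemicontinuousOn (fun p : ℝ × PathSp n h T => φ p.1 p.2)
    (Set.Icc 0 T ×ˢ (Set.univ : Set (PathSp n h T))) ∧
  (∀ x : PathSp n h T, φ T x ≤ σ x) ∧
  PropL H cH φ

/-- Minimax solution of the Cauchy problem. -/
def MinimaxSol {n : ℕ} {h T : ℝ} (H : ℝ → PathSp n h T → Euc n → ℝ) (cH : ℝ → ℝ)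
    (σ : PathSp n h T → ℝ) (φ : ℝ → PathSp n h T → ℝ) : Prop :=
  UpperSol H cH σ φ ∧ LowerSol H cH σ φ

/-- `φ` is ci-differentiable at `(t,x(·))` with ci-derivatives `a = ∂ₜφ(t,x(·))`
and `g = ∇φ(t,x(·))`. -/
def HasCiDeriv {n : ℕ} {h T : ℝ} (φ : ℝ → PathSp n h T → ℝ)
    (t : ℝ) (x : PathSp n h T) (a : ℝ) (g : Euc n) : Prop :=
  ∀ p ∈ ACPair t x, ∃ o : ℝ → ℝ,
    (∀ τ ∈ Set.Ioc t T,
      φ τ p.1 - φ t x =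
        a * (τ - t) + @inner ℝ _ _ g (evalP p.1 τ - evalP x t) + o (τ - t)) ∧
    Tendsto (fun τ => o (τ - t) / (τ - t + ∫ ξ in t..τ, ‖p.2 ξ‖))
      (nhdsWithin t (Set.Ioi t)) (nhds 0)

/-- `φ ∈ Φ`, with the ci-derivatives `Dt = ∂ₜφ`, `Dx = ∇φ` and the full-measure
set `Eφ` of ci-differentiability made explicit. -/
structure IsInPhi {n : ℕ} {h T : ℝ} (φ : ℝ → PathSp n h T → ℝ)
    (Dt : ℝ → PathSp n h T → ℝ) (Dx : ℝ → PathSp n h T → Euc n)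
    (Eφ : Set ℝ) : Prop where
  cont : ContinuousOn (fun p : ℝ × PathSp n h T => φ p.1 p.2)
    (Set.Icc 0 T ×ˢ (Set.univ : Set (PathSp n h T)))
  absCont : ∀ t ∈ Set.Ico (0:ℝ) T, ∀ x : PathSp n h T, ∀ p ∈ ACPair t x,
    ∀ θ ∈ Set.Ioo t T, ∃ g : ℝ → ℝ, IntervalIntegrable g volume t θ ∧
      ∀ τ ∈ Set.Icc t θ, φ τ p.1 = φ t p.1 + ∫ ξ in t..τ, g ξ
  Esub : Eφ ⊆ Set.Ico 0 T
  Efull : volume Eφ = ENNReal.ofReal T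
  ciDiff : ∀ t ∈ Eφ, ∀ x : PathSp n h T, HasCiDeriv φ t x (Dt t x) (Dx t x)
  measD : ∀ x : PathSp n h T, Measurable (Eφ.restrict (fun t => (Dt t x, Dx t x)))
  contD : ∀ t ∈ Eφ, Continuous (fun x : PathSp n h T => (Dt t x, Dx t x))
  bddD : ∀ D : Set (PathSp n h T), IsCompact D → ∀ θ ∈ Set.Ico (0:ℝ) T,
    ∃ m : ℝ → ℝ, (IntegrableOn m (Set.Icc 0 θ) volume ∧ ∀ τ ∈ Set.Icc (0:ℝ) θ, 0 ≤ m τ) ∧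
      ∃ ℓ : ℝ, 0 < ℓ ∧ ∀ t ∈ Eφ ∩ Set.Icc 0 θ, ∀ x ∈ D, |Dt t x| ≤ m t ∧ ‖Dx t x‖ ≤ ℓ

/-- Semiclassical solution of the Cauchy problem (with derivative data). -/
def SemiclassicalSol {n : ℕ} {h T : ℝ} (H : ℝ → PathSp n h T → Euc n → ℝ)
    (σ : PathSp n h T → ℝ) (φ : ℝ → PathSp n h T → ℝ)
    (Dt : ℝ → PathSp n h T → ℝ) (Dx : ℝ → PathSp n h T → Euc n) (Eφ : Set ℝ) : Prop :=
  IsInPhi φ Dt Dx Eφ ∧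
  (∀ t ∈ Eφ, ∀ x : PathSp n h T, Dt t x + H t x (Dx t x) = 0) ∧
  ∀ x : PathSp n h T, φ T x = σ x

/-- The Steklov transform of `H` with respect to the first (time) variable,
with `H` extended by `0` outside `[0,T]`. -/
def steklov {n : ℕ} {h T : ℝ} (H : ℝ → PathSp n h T → Euc n → ℝ) (k : ℕ)
    (t : ℝ) (x : PathSp n h T) (s : Euc n) : ℝ :=
  ((k : ℝ) / 2) * ∫ τ in (t - (k : ℝ)⁻¹)..(t + (k : ℝ)⁻¹),
    (if τ ∈ Set.Icc (0:ℝ) T then H τ (stopPath t x) s else 0)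

/-! ### Differential game definitions -/

/-- Admissible controls with values in `P`. -/
def Ctrl {m : ℕ} (P : Set (Euc m)) : Set (ℝ → Euc m) :=
  {u | Measurable u ∧ ∀ τ, u τ ∈ P}

/-- Non-anticipative strategies mapping `Q`-valued controls to `P`-valued controls
on the interval `[t,T]`. -/
def NAStrat {mP mQ : ℕ} (P : Set (Euc mP)) (Q : Set (Euc mQ)) (t T : ℝ) :
    Set ((ℝ → Euc mQ) → ℝ → Euc mP) :=
  {α | (∀ v ∈ Ctrl Q, α v ∈ Ctrl P) ∧
    ∀ τ ∈ Set.Icc t T, ∀ v ∈ Ctrl Q, ∀ v' ∈ Ctrl Q,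
      (∀ᵐ ξ ∂(volume.restrict (Set.Icc t τ)), v ξ = v' ξ) →
      (∀ᵐ ξ ∂(volume.restrict (Set.Icc t τ)), α v ξ = α v' ξ)}

/-- `(y, y')` is (the derivative-witnessed) motion of the time-delay system
generated by `f` from `(t,x(·))` under controls `u(·)`, `v(·)`. -/
def IsMotion {n : ℕ} {h T : ℝ} {mP mQ : ℕ}
    (f : ℝ → PathSp n h T → Euc mP → Euc mQ → Euc n)
    (t : ℝ) (x : PathSp n h T) (u : ℝ → Euc mP) (v : ℝ → Euc mQ)
    (p : PathSp n h T × (ℝ → Euc n)) : Prop :=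
  p ∈ ACPair t x ∧
  ∀ᵐ τ ∂(volume.restrict (Set.Icc t T)), p.2 τ = f τ p.1 (u τ) (v τ)

/-- The set of values of the cost functional along motions (a singleton when
the motion exists and is unique). -/
def costVals {n : ℕ} {h T : ℝ} {mP mQ : ℕ}
    (f : ℝ → PathSp n h T → Euc mP → Euc mQ → Euc n)
    (χ : ℝ → PathSp n h T → Euc mP → Euc mQ → ℝ) (σ : PathSp n h T → ℝ)
    (t : ℝ) (x : PathSp n h T) (u : ℝ → Euc mP) (v : ℝ → Euc mQ) : Set ℝ :=
  {r | ∃ p : PathSp n h T × (ℝ → Euc n), IsMotion f t x u v p ∧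
        r = σ p.1 - ∫ τ in t..T, χ τ p.1 (u τ) (v τ)}

/-- The lower value `ρ⁻(t,x(·))` of the differential game. -/
def lowerValue {n : ℕ} {h T : ℝ} {mP mQ : ℕ} (P : Set (Euc mP)) (Q : Set (Euc mQ))
    (f : ℝ → PathSp n h T → Euc mP → Euc mQ → Euc n)
    (χ : ℝ → PathSp n h T → Euc mP → Euc mQ → ℝ) (σ : PathSp n h T → ℝ)
    (t : ℝ) (x : PathSp n h T) : ℝ :=
  sInf ((fun α => sSup (⋃ v ∈ Ctrl Q, costVals f χ σ t x (α v) v)) '' NAStrat P Q t T)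

/-- The upper value `ρ⁺(t,x(·))` of the differential game. -/
def upperValue {n : ℕ} {h T : ℝ} {mP mQ : ℕ} (P : Set (Euc mP)) (Q : Set (Euc mQ))
    (f : ℝ → PathSp n h T → Euc mP → Euc mQ → Euc n)
    (χ : ℝ → PathSp n h T → Euc mP → Euc mQ → ℝ) (σ : PathSp n h T → ℝ)
    (t : ℝ) (x : PathSp n h T) : ℝ :=
  sSup ((fun β => sInf (⋃ u ∈ Ctrl P, costVals f χ σ t x u (β u))) '' NAStrat Q P t T)

/-- The lower Hamiltonian `H⁻` (defined via the full-measure set `EC` from (C.2)). -/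
def Hlow {n : ℕ} {h T : ℝ} {mP mQ : ℕ} (P : Set (Euc mP)) (Q : Set (Euc mQ))
    (f : ℝ → PathSp n h T → Euc mP → Euc mQ → Euc n)
    (χ : ℝ → PathSp n h T → Euc mP → Euc mQ → ℝ) (EC : Set ℝ)
    (τ : ℝ) (y : PathSp n h T) (s : Euc n) : ℝ :=
  if τ ∈ EC then
    sSup ((fun v => sInf ((fun u => @inner ℝ _ _ s (f τ y u v) - χ τ y u v) '' P)) '' Q)
  else 0

/-- The upper Hamiltonian `H⁺` (defined via the full-measure set `EC` from (C.2)). -/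
def Hup {n : ℕ} {h T : ℝ} {mP mQ : ℕ} (P : Set (Euc mP)) (Q : Set (Euc mQ))
    (f : ℝ → PathSp n h T → Euc mP → Euc mQ → Euc n)
    (χ : ℝ → PathSp n h T → Euc mP → Euc mQ → ℝ) (EC : Set ℝ)
    (τ : ℝ) (y : PathSp n h T) (s : Euc n) : ℝ :=
  if τ ∈ EC then
    sInf ((fun u => sSup ((fun v => @inner ℝ _ _ s (f τ y u v) - χ τ y u v) '' Q)) '' P)
  else 0

/-- Assumption (C) on the data `(f, χ, σ)` of the differential game, with the
full-measure set `EC` from (C.2) and the function `c_f(·)` from (C.4) explicit. -/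
structure AssumpC {n : ℕ} {h T : ℝ} {mP mQ : ℕ} (P : Set (Euc mP)) (Q : Set (Euc mQ))
    (f : ℝ → PathSp n h T → Euc mP → Euc mQ → Euc n)
    (χ : ℝ → PathSp n h T → Euc mP → Euc mQ → ℝ)
    (σ : PathSp n h T → ℝ) (EC : Set ℝ) (cf : ℝ → ℝ) : Prop where
  meas : ∀ (y : PathSp n h T) (u : Euc mP) (v : Euc mQ),
    Measurable ((Set.Icc (0:ℝ) T).restrict (fun τ => (f τ y u v, χ τ y u v)))
  ECsub : EC ⊆ Set.Icc 0 T
  ECfull : volume EC = ENNReal.ofReal T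
  contOn : ∀ τ ∈ EC, ContinuousOn
    (fun p : PathSp n h T × Euc mP × Euc mQ => (f τ p.1 p.2.1 p.2.2, χ τ p.1 p.2.1 p.2.2))
    ((Set.univ : Set (PathSp n h T)) ×ˢ P ×ˢ Q)
  lip : ∀ D : Set (PathSp n h T), IsCompact D → ∃ lam : ℝ → ℝ, IntegNonneg T lam ∧
    ∃ E : Set ℝ, E ⊆ Set.Icc 0 T ∧ volume E = ENNReal.ofReal T ∧
      ∀ τ ∈ E, ∀ y₁ ∈ D, ∀ y₂ ∈ D, ∀ u ∈ P, ∀ v ∈ Q,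
        ‖f τ y₁ u v - f τ y₂ u v‖ + |χ τ y₁ u v - χ τ y₂ u v| ≤
          lam τ * ‖stopPath τ y₁ - stopPath τ y₂‖
  growth : IntegNonneg T cf ∧
    ∃ E : Set ℝ, E ⊆ Set.Icc 0 T ∧ volume E = ENNReal.ofReal T ∧
      ∀ τ ∈ E, ∀ y : PathSp n h T, ∀ u ∈ P, ∀ v ∈ Q,
        ‖f τ y u v‖ ≤ cf τ * (1 + ‖stopPath τ y‖)
  bdd : ∀ D : Set (PathSp n h T), IsCompact D → ∃ m : ℝ → ℝ, IntegNonneg T m ∧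
    ∃ E : Set ℝ, E ⊆ Set.Icc 0 T ∧ volume E = ENNReal.ofReal T ∧
      ∀ τ ∈ E, ∀ y ∈ D, ∀ u ∈ P, ∀ v ∈ Q, |χ τ y u v| ≤ m τ
  sigC : Continuous σ


/-- A property holding on a set of full outer measure holds a.e. if null-measurable. -/
lemma aux_full {T : ℝ} {E : Set ℝ} (hE : E ⊆ Set.Icc 0 T)
    (hv : volume E = ENNReal.ofReal T) {p : ℝ → Prop} (hp : ∀ t ∈ E, p t)
    (hm : NullMeasurableSet {t | p t} (volume.restrict (Set.Icc 0 T))) :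
    ∀ᵐ t ∂(volume.restrict (Set.Icc (0:ℝ) T)), p t := by
  rw [ae_iff_measure_eq hm]
  apply le_antisymm (measure_mono (subset_univ _))
  have h1 : (volume.restrict (Set.Icc 0 T)) E = ENNReal.ofReal T := by
    rw [Measure.restrict_apply' measurableSet_Icc, inter_eq_left.mpr hE, hv]
  calc (volume.restrict (Set.Icc (0:ℝ) T)) univ = ENNReal.ofReal T := by simp
    _ = (volume.restrict (Set.Icc 0 T)) E := h1.symm
    _ ≤ _ := measure_mono hp

lemma aux_leb {T : ℝ} (hT : 0 < T) {f : ℝ → ℝ} (hf : IntegrableOn f (Set.Icc 0 T) volume) :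
    ∀ᵐ t ∂(volume.restrict (Set.Icc (0:ℝ) T)),
      Tendsto (fun τ => (τ - t)⁻¹ * ∫ ξ in t..τ, f ξ) (𝓝[>] t) (𝓝 (f t)) := by
  have h1 : IntervalIntegrable f volume 0 T :=
    (intervalIntegrable_iff_integrableOn_Icc_of_le hT.le).mpr hf
  rw [ae_restrict_iff' measurableSet_Icc]
  filter_upwards [h1.ae_hasDerivAt_integral] with t ht hmem
  rw [← uIcc_of_le hT.le] at hmem
  have h2 := (ht hmem t hmem).hasDerivWithinAt (s := Ioi t)
  rw [hasDerivWithinAt_iff_tendsto_slope' (by simp)] at h2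
  refine h2.congr fun τ => ?_
  simp [slope_def_field, div_eq_inv_mul]

lemma norm_stopPath_le {n : ℕ} {h T : ℝ} (t : ℝ) (x : PathSp n h T) :
    ‖stopPath t x‖ ≤ ‖x‖ :=
  (ContinuousMap.norm_le _ (norm_nonneg _)).mpr fun _ => x.norm_coe_le_norm _

lemma norm_stopPath_sub_le {n : ℕ} {h T : ℝ} (t : ℝ) (x y : PathSp n h T) :
    ‖stopPath t x - stopPath t y‖ ≤ ‖x - y‖ :=
  norm_stopPath_le t (x - y)

lemma aux_avg {T t a ε : ℝ} (ht : t ∈ Set.Ico 0 T) {f g b : ℝ → ℝ}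
    (hf : IntegrableOn f (Set.Icc 0 T) volume) (hg : IntegrableOn g (Set.Icc 0 T) volume)
    (hb : IntegrableOn b (Set.Icc 0 T) volume)
    (hfg : ∀ᵐ ξ ∂(volume.restrict (Set.Icc (0:ℝ) T)), |f ξ - g ξ| ≤ b ξ)
    (hgt : Tendsto (fun τ => (τ - t)⁻¹ * ∫ ξ in t..τ, g ξ) (𝓝[>] t) (𝓝 (g t)))
    (hbt : Tendsto (fun τ => (τ - t)⁻¹ * ∫ ξ in t..τ, b ξ) (𝓝[>] t) (𝓝 (b t)))
    (hε : |g t - a| + b t < ε) :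
    ∀ᶠ τ in 𝓝[>] t, |(τ - t)⁻¹ * (∫ ξ in t..τ, f ξ) - a| < ε := by
  have h1 : Tendsto (fun τ => |(τ - t)⁻¹ * (∫ ξ in t..τ, g ξ) - a| +
      (τ - t)⁻¹ * ∫ ξ in t..τ, b ξ) (𝓝[>] t) (𝓝 (|g t - a| + b t)) :=
    ((hgt.sub_const a).abs).add hbt
  filter_upwards [h1.eventually_lt_const hε, Ioo_mem_nhdsGT ht.2] with τ h2 h3
  have hsub : Set.Icc t τ ⊆ Set.Icc 0 T := Icc_subset_Icc ht.1 h3.2.le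
  have key : ∀ {k : ℝ → ℝ}, IntegrableOn k (Set.Icc 0 T) volume →
      IntervalIntegrable k volume t τ := fun hk =>
    (intervalIntegrable_iff_integrableOn_Icc_of_le h3.1.le).mpr (hk.mono_set hsub)
  have h4 : |∫ ξ in t..τ, (f ξ - g ξ)| ≤ ∫ ξ in t..τ, b ξ := by
    refine (intervalIntegral.abs_integral_le_integral_abs h3.1.le).trans ?_
    refine intervalIntegral.integral_mono_ae_restrict h3.1.le ((key hf).sub (key hg)).abs
      (key hb) ?_
    exact ae_mono (Measure.restrict_mono hsub le_rfl) hfg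
  rw [intervalIntegral.integral_sub (key hf) (key hg)] at h4
  have hpos : 0 < (τ - t)⁻¹ := inv_pos.mpr (sub_pos.mpr h3.1)
  have h5 := mul_le_mul_of_nonneg_left h4 hpos.le
  rw [← abs_of_pos hpos, ← abs_mul, abs_of_pos hpos, mul_sub] at h5
  refine lt_of_le_of_lt ?_ h2
  have h6 := abs_add_le ((τ - t)⁻¹ * (∫ ξ in t..τ, f ξ) - (τ - t)⁻¹ * (∫ ξ in t..τ, g ξ))
    ((τ - t)⁻¹ * (∫ ξ in t..τ, g ξ) - a)
  rw [sub_add_sub_cancel] at h6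
  linarith

/-- Lemma on Lebesgue points: uniform-in-`(x,s)` Lebesgue points
of the Hamiltonian in the time variable. -/
theorem stmt2 {n : ℕ} {h T : ℝ} (hT : 0 < T) (hh : 0 ≤ h)
    (H : ℝ → PathSp n h T → Euc n → ℝ) (cH : ℝ → ℝ) (hH : CondA H cH)
    (D : Set (PathSp n h T)) (hD : IsCompact D) :
    ∃ E : Set ℝ, E ⊆ Set.Ico 0 T ∧ volume E = ENNReal.ofReal T ∧
      ∀ t ∈ E, ∀ x ∈ D, ∀ s : Euc n,
        Tendsto (fun τ => (τ - t)⁻¹ * ∫ ξ in t..τ, H ξ x s)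
          (nhdsWithin t (Set.Ioi t)) (nhds (H t x s)) := by
  obtain ⟨hA1, ⟨E2, hE2, hE2v, hcont⟩, hA3, ⟨⟨hci, hc0⟩, E4, hE4, hE4v, hlip⟩, hA5⟩ := hH
  obtain ⟨lam, ⟨hli, hl0⟩, hlam⟩ := hA3 D hD
  obtain ⟨m, ⟨hmi, hm0⟩, hm⟩ := hA5 D hD
  set ν := volume.restrict (Set.Icc (0:ℝ) T) with hν
  have hmeas : ∀ x s, AEMeasurable (fun t => H t x s) ν := fun x s =>
    aemeasurable_restrict_of_measurable_subtype measurableSet_Icc (hA1 x s)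
  have hlm : AEMeasurable lam ν := hli.1.aemeasurable
  have hcm : AEMeasurable cH ν := hci.1.aemeasurable
  have hmm : AEMeasurable m ν := hmi.1.aemeasurable
  -- a.e. versions of the bounds
  have b3 : ∀ x₁ ∈ D, ∀ x₂ ∈ D, ∀ s : Euc n, ∀ᵐ t ∂ν,
      |H t x₁ s - H t x₂ s| ≤ lam t * ((1 + ‖s‖) * ‖x₁ - x₂‖) := by
    intro x₁ h₁ x₂ h₂ s
    obtain ⟨E, hE, hEv, hb⟩ := hlam x₁ h₁ x₂ h₂ s
    refine aux_full hE hEv (fun t ht => (hb t ht).trans ?_) ?_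
    · rw [mul_assoc]
      have := hl0 t (hE ht)
      have := norm_stopPath_sub_le t x₁ x₂
      gcongr
    · exact nullMeasurableSet_le ((hmeas _ _).sub (hmeas _ _)).norm (hlm.mul_const _)
  have b4 : ∀ (x : PathSp n h T) (s₁ s₂ : Euc n), ∀ᵐ t ∂ν,
      |H t x s₁ - H t x s₂| ≤ cH t * ((1 + ‖x‖) * ‖s₁ - s₂‖) := by
    intro x s₁ s₂
    refine aux_full hE4 hE4v (fun t ht => (hlip t ht x s₁ s₂).trans ?_) ?_
    · rw [mul_assoc]
      have := hc0 t (hE4 ht)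
      have := norm_stopPath_le t x
      gcongr
    · exact nullMeasurableSet_le ((hmeas _ _).sub (hmeas _ _)).norm (hcm.mul_const _)
  have b5 : ∀ x ∈ D, ∀ᵐ t ∂ν, |H t x 0| ≤ m t := by
    intro x hx
    obtain ⟨E, hE, hEv, hb⟩ := hm x hx
    exact aux_full hE hEv hb (nullMeasurableSet_le (hmeas _ _).norm hmm)
  have hint : ∀ x ∈ D, ∀ s, IntegrableOn (fun t => H t x s) (Set.Icc 0 T) volume := by
    intro x hx s
    refine Integrable.mono' (hmi.add (hci.mul_const ((1 + ‖x‖) * ‖s - 0‖)))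
      (hmeas x s).aestronglyMeasurable ?_
    filter_upwards [b5 x hx, b4 x s 0] with t h1 h2
    have h3 := abs_add_le (H t x s - H t x 0) (H t x 0)
    rw [sub_add_cancel] at h3
    simp only [Real.norm_eq_abs, Pi.add_apply]
    linarith
  haveI : TopologicalSpace.SeparableSpace D := hD.isSeparable.separableSpace
  obtain ⟨S, hSc, hSd⟩ := TopologicalSpace.exists_countable_dense (D × Euc n)
  have hG : ∀ᵐ t ∂ν, t ∈ Set.Ico 0 T ∧
      Tendsto (fun τ => (τ - t)⁻¹ * ∫ ξ in t..τ, lam ξ) (𝓝[>] t) (𝓝 (lam t)) ∧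
      Tendsto (fun τ => (τ - t)⁻¹ * ∫ ξ in t..τ, cH ξ) (𝓝[>] t) (𝓝 (cH t)) ∧
      ∀ p ∈ S, Tendsto (fun τ => (τ - t)⁻¹ * ∫ ξ in t..τ, H ξ p.1 p.2) (𝓝[>] t)
        (𝓝 (H t p.1 p.2)) := by
    have h1 : ∀ᵐ t ∂ν, t ∈ Set.Ico 0 T := by
      rw [hν, ← Measure.restrict_congr_set Ico_ae_eq_Icc]
      exact ae_restrict_mem measurableSet_Ico
    have h2 := (ae_ball_iff hSc).mpr fun p (_ : p ∈ S) =>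
      aux_leb hT (hint p.1 p.1.2 p.2)
    filter_upwards [h1, aux_leb hT hli, aux_leb hT hci, h2] with t a b c d
    exact ⟨a, b, c, d⟩
  set G := {t | t ∈ Set.Ico 0 T ∧
      Tendsto (fun τ => (τ - t)⁻¹ * ∫ ξ in t..τ, lam ξ) (𝓝[>] t) (𝓝 (lam t)) ∧
      Tendsto (fun τ => (τ - t)⁻¹ * ∫ ξ in t..τ, cH ξ) (𝓝[>] t) (𝓝 (cH t)) ∧
      ∀ p ∈ S, Tendsto (fun τ => (τ - t)⁻¹ * ∫ ξ in t..τ, H ξ p.1 p.2) (𝓝[>] t)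
        (𝓝 (H t p.1 p.2))} with hGdef
  refine ⟨E2 ∩ G, fun t ht => ht.2.1, ?_, ?_⟩
  · have h1 : ν (E2 ∩ G) = ν E2 :=
      measure_congr (inter_ae_eq_left_of_ae_eq_univ (eventuallyEq_univ.mpr hG))
    rw [hν, Measure.restrict_apply' measurableSet_Icc, Measure.restrict_apply' measurableSet_Icc,
      inter_eq_left.mpr hE2, inter_eq_left.mpr (inter_subset_left.trans hE2), hE2v] at h1
    exact h1
  · rintro t ⟨ht2, htI, htl, htc, htS⟩ x hx s
    rw [Metric.tendsto_nhds]
    intro ε hε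
    simp only [Real.dist_eq]
    let F : D × Euc n → ℝ := fun p => |H t p.1 p.2 - H t x s| +
      (lam t * ((1 + ‖s‖) * ‖x - p.1‖) + cH t * ((1 + ‖(p.1 : PathSp n h T)‖) * ‖s - p.2‖))
    have hHc : Continuous fun p : D × Euc n => H t p.1 p.2 :=
      (hcont t ht2).comp (by fun_prop : Continuous fun p : D × Euc n => ((p.1 : PathSp n h T), p.2))
    have hF : Continuous F := by
      have h1 : Continuous fun p : D × Euc n => (p.1 : PathSp n h T) := by fun_prop
      exact ((hHc.sub continuous_const).abs).add
        ((continuous_const.mul (continuous_const.mul (continuous_const.sub h1).norm)).add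
        (continuous_const.mul ((continuous_const.add h1.norm).mul
          (continuous_const.sub continuous_snd).norm)))
    have hne : (F ⁻¹' Iio ε).Nonempty := ⟨(⟨x, hx⟩, s), by simpa [F] using hε⟩
    obtain ⟨p, hpF, hpS⟩ := hSd.inter_open_nonempty _ (isOpen_Iio.preimage hF) hne
    refine aux_avg (b := fun ξ => lam ξ * ((1 + ‖s‖) * ‖x - p.1‖) +
      cH ξ * ((1 + ‖(p.1 : PathSp n h T)‖) * ‖s - p.2‖)) htI (hint x hx s)
      (hint p.1 p.1.2 p.2) ((hli.mul_const _).add (hci.mul_const _)) ?_ (htS p hpS) ?_ hpF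
    · filter_upwards [b3 x hx p.1 p.1.2 s, b4 p.1 s p.2] with ξ h1 h2
      have h3 := abs_add_le (H ξ x s - H ξ p.1 s) (H ξ p.1 s - H ξ p.1 p.2)
      rw [sub_add_sub_cancel] at h3
      linarith
    · have h1 := (htl.mul_const ((1 + ‖s‖) * ‖x - p.1‖)).add
        (htc.mul_const ((1 + ‖(p.1 : PathSp n h T)‖) * ‖s - p.2‖))
      refine h1.congr' ?_
      filter_upwards [Ioo_mem_nhdsGT htI.2] with τ h3
      have hsub : Set.Icc t τ ⊆ Set.Icc 0 T := Icc_subset_Icc htI.1 h3.2.le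
      have key : ∀ {k : ℝ → ℝ}, IntegrableOn k (Set.Icc 0 T) volume →
          IntervalIntegrable k volume t τ := fun hk =>
        (intervalIntegrable_iff_integrableOn_Icc_of_le h3.1.le).mpr (hk.mono_set hsub)
      rw [intervalIntegral.integral_add ((key hli).mul_const _) ((key hci).mul_const _),
        intervalIntegral.integral_mul_const, intervalIntegral.integral_mul_const]
      ring

end
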